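/- For any reals a, b, c, f with f > 0: (√((a+f)² + (b+f)²) − √(a² + b²))² ≤ 2f², provided a² + b² + a·f + b·f ≥ 0. -/

import Mathlib

theorem stmt_3 (a b c f : ℝ) (hf : 0 < f) (h : a ^ 2 + b ^ 2 + a * f + b * f ≥ 0) :
    (Real.sqrt ((a + f) ^ 2 + (b + f) ^ 2) - Real.sqrt (a ^ 2 + b ^ 2)) ^ 2 ≤ 2 * f ^ 2 := by
  have hS : Real.sqrt ((a + f) ^ 2 + (b + f) ^ 2) ^ 2 = (a + f) ^ 2 + (b + f) ^ 2 :=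
    Real.sq_sqrt (by positivity)
  have hT : Real.sqrt (a ^ 2 + b ^ 2) ^ 2 = a ^ 2 + b ^ 2 := Real.sq_sqrt (by positivity)
  have cauchy_schwarz : a ^ 2 + b ^ 2 + a * f + b * f ≤
      Real.sqrt ((a + f) ^ 2 + (b + f) ^ 2) * Real.sqrt (a ^ 2 + b ^ 2) := by
    refine (le_abs_self _).trans (abs_le_of_sq_le_sq ?_ (by positivity))
    rw [mul_pow, hS, hT]
    nlinarith [sq_nonneg (f * (a - b))]
  nlinarith
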